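/- Let (X,d) be a separable metric space and let f : X → ℝ be continuous. Define the curve-fragment space Frag(X) := { G : G is a nonempty compact subset of ℝ × X, G ⊆ [0,1] × X, and d(x,y) ≤ |s−t| for all (s,x), (t,y) ∈ G }, equipped with the Hausdorff metric inherited from the space of nonempty compact subsets of ℝ × X. For G ∈ Frag(X) set dom(G) := { s : ∃x, (s,x) ∈ G }, and for t ∈ dom(G) let e(t,G) denote the unique x ∈ X with (t,x) ∈ G. Let Γ̄(X) := { (t,G) ∈ ℝ × Frag(X) : t ∈ dom(G) }. Then the set D(f) := { (t,G) ∈ Γ̄(X) : t is a limit point of dom(G) and the limit lim_{dom(G) ∋ s → t} ( f(e(s,G)) − f(e(t,G)) ) / (s−t) exists } is a Borel subset of ℝ × Frag(X), and the map on Γ̄(X) that sends (t,G) ∈ D(f) to this limit (the derivative of f along the fragment at t) and sends every other (t,G) ∈ Γ̄(X) to 0 is Borel measurable. -/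

import Mathlib

open Filter Topology TopologicalSpace MeasureTheory
open scoped Classical

/-- The space of curve fragments of `X`: nonempty compact subsets `G ⊆ [0,1] × X` of `ℝ × X`
(with the sup metric) satisfying `d(x,y) ≤ |s−t|` for all `(s,x), (t,y) ∈ G`, i.e. graphs of
1-Lipschitz maps defined on nonempty compact subsets of `[0,1]`, with the Hausdorff metric. -/
def Frag (X : Type*) [MetricSpace X] : Type _ :=
  { G : NonemptyCompacts (ℝ × X) //
      (∀ p ∈ (G : Set (ℝ × X)), p.1 ∈ Set.Icc (0:ℝ) 1) ∧
      (∀ p ∈ (G : Set (ℝ × X)), ∀ q ∈ (G : Set (ℝ × X)), dist p.2 q.2 ≤ |p.1 - q.1|) }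

noncomputable instance (X : Type*) [MetricSpace X] : MetricSpace (Frag X) := by
  unfold Frag; infer_instance

/-- The (compact) domain of a fragment. -/
def Frag.domSet {X : Type*} [MetricSpace X] (G : Frag X) : Set ℝ :=
  {s : ℝ | ∃ x : X, (s, x) ∈ (G.1 : Set (ℝ × X))}

/-- Evaluation of a fragment: for `s ∈ dom G`, `G.eval s` is the unique `x` with
`(s,x) ∈ G` (and a junk value otherwise). -/
noncomputable def Frag.eval {X : Type*} [MetricSpace X] (G : Frag X) (s : ℝ) : X :=
  if h : ∃ x : X, (s, x) ∈ (G.1 : Set (ℝ × X)) then h.choose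
  else (G.1.nonempty.choose).2


section Helpers

variable {X : Type*} [MetricSpace X]

lemma Frag.exists_near (G H : Frag X) {r : ℝ} (h : dist G H < r) (z : ℝ × X)
    (hz : z ∈ (G.1 : Set (ℝ × X))) : ∃ w ∈ (H.1 : Set (ℝ × X)), dist z w < r := by
  have h' : Metric.hausdorffDist (G.1 : Set (ℝ × X)) (H.1 : Set (ℝ × X)) < r := h
  exact Metric.exists_dist_lt_of_hausdorffDist_lt hz h'
    (Metric.hausdorffEDist_ne_top_of_nonempty_of_bounded G.1.nonempty H.1.nonempty
      G.1.isCompact.isBounded H.1.isCompact.isBounded)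

lemma Frag.eval_mem (G : Frag X) {s : ℝ} (h : s ∈ G.domSet) :
    (s, G.eval s) ∈ (G.1 : Set (ℝ × X)) := by
  have h' : ∃ x : X, (s, x) ∈ (G.1 : Set (ℝ × X)) := h
  unfold Frag.eval
  rw [dif_pos h']
  exact h'.choose_spec

lemma Frag.eval_eq (G : Frag X) {z : ℝ × X} (h : z ∈ (G.1 : Set (ℝ × X))) :
    G.eval z.1 = z.2 := by
  have h1 := G.eval_mem (s := z.1) ⟨z.2, h⟩
  have h2 := G.2.2 _ h1 _ h
  simp only [sub_self, abs_zero] at h2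
  exact dist_le_zero.mp h2

lemma Frag.isClosed_domSet (G : Frag X) : IsClosed G.domSet := by
  have : G.domSet = Prod.fst '' (G.1 : Set (ℝ × X)) := by
    ext s; simp [Frag.domSet]
  rw [this]
  exact (G.1.isCompact.image continuous_fst).isClosed

lemma Frag.isClosed_gamma : IsClosed {p : ℝ × Frag X | p.1 ∈ p.2.domSet} := by
  apply isClosed_of_closure_subset
  rintro ⟨t, G⟩ hp
  change t ∈ G.domSet
  rw [← G.isClosed_domSet.closure_eq, Metric.mem_closure_iff]
  intro ε hε
  obtain ⟨⟨t', G'⟩, ⟨x', hx'⟩, hd⟩ := Metric.mem_closure_iff.mp hp (ε / 2) (by linarith)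
  rw [Prod.dist_eq, max_lt_iff] at hd
  simp only at hd hx'
  obtain ⟨⟨s, y⟩, hw, hwd⟩ := Frag.exists_near G' G (by rw [dist_comm]; exact hd.2) _ hx'
  refine ⟨s, ⟨y, hw⟩, ?_⟩
  rw [Prod.dist_eq, max_lt_iff] at hwd
  have := dist_triangle t t' s
  simp only at hwd
  linarith [hd.1, hwd.1]

lemma Frag.isOpen_hit (W : Set ((ℝ × X) × (ℝ × X))) (hW : IsOpen W) :
    IsOpen {p : {p : ℝ × Frag X // p.1 ∈ p.2.domSet} |
      ∃ z ∈ (p.1.2.1 : Set (ℝ × X)), ((p.1.1, p.1.2.eval p.1.1), z) ∈ W} := by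
  rw [Metric.isOpen_iff]
  rintro ⟨⟨t, G⟩, ht⟩ ⟨z, hz, hzW⟩
  simp only at hz hzW ht
  obtain ⟨r, hr, hrW⟩ := Metric.isOpen_iff.mp hW _ hzW
  refine ⟨r / 3, by linarith, ?_⟩
  rintro ⟨⟨t', G'⟩, ht'⟩ hd
  rw [Metric.mem_ball, Subtype.dist_eq, Prod.dist_eq, max_lt_iff] at hd
  simp only at hd ht'
  have hd2 : dist G G' < r / 3 := by rw [dist_comm]; exact hd.2
  obtain ⟨w, hw, hwd⟩ := Frag.exists_near G G' hd2 z hz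
  obtain ⟨v, hv, hvd⟩ := Frag.exists_near G G' hd2 _ (G.eval_mem ht)
  refine ⟨w, hw, hrW ?_⟩
  rw [Prod.dist_eq, max_lt_iff] at hvd
  simp only at hvd
  have h1 := G'.2.2 _ (G'.eval_mem ht') _ hv
  simp only [← Real.dist_eq] at h1
  have h2 := dist_triangle t' t v.1
  have h3 := dist_triangle_right (G'.eval t') (G.eval t) v.2
  rw [Metric.mem_ball, Prod.dist_eq, Prod.dist_eq, max_lt_iff, max_lt_iff]
  simp only
  refine ⟨⟨by linarith [hd.1], by linarith [hd.1, hvd.1, hvd.2]⟩, ?_⟩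
  rw [dist_comm]; linarith

/-- pairs for which some difference quotient at scale `δ` lies in `V` -/
def Frag.hitSet (f : X → ℝ) (V : Set ℝ) (δ : ℝ) :
    Set {p : ℝ × Frag X // p.1 ∈ p.2.domSet} :=
  {p | ∃ s ∈ p.1.2.domSet, s ≠ p.1.1 ∧ |s - p.1.1| < δ ∧
    (f (p.1.2.eval s) - f (p.1.2.eval p.1.1)) / (s - p.1.1) ∈ V}

lemma Frag.isOpen_hitSet (f : X → ℝ) (hf : Continuous f) (V : Set ℝ) (hV : IsOpen V) (δ : ℝ) :
    IsOpen (Frag.hitSet f V δ) := by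
  have hW : IsOpen {q : (ℝ × X) × (ℝ × X) | (q.2.1 ≠ q.1.1 ∧ |q.2.1 - q.1.1| < δ) ∧
      (f q.2.2 - f q.1.2) / (q.2.1 - q.1.1) ∈ V} := by
    have h1 : IsOpen {q : (ℝ × X) × (ℝ × X) | q.2.1 ≠ q.1.1 ∧ |q.2.1 - q.1.1| < δ} := by
      have a : IsOpen {q : (ℝ × X) × (ℝ × X) | q.2.1 ≠ q.1.1} :=
        isOpen_ne_fun (by fun_prop) (by fun_prop)
      have b : IsOpen {q : (ℝ × X) × (ℝ × X) | |q.2.1 - q.1.1| < δ} :=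
        isOpen_lt (by fun_prop) (by fun_prop)
      exact a.inter b
    have h2 : ContinuousOn (fun q : (ℝ × X) × (ℝ × X) =>
        (f q.2.2 - f q.1.2) / (q.2.1 - q.1.1))
        {q : (ℝ × X) × (ℝ × X) | q.2.1 ≠ q.1.1 ∧ |q.2.1 - q.1.1| < δ} := by
      apply ContinuousOn.div (by fun_prop) (by fun_prop)
      intro q hq
      exact sub_ne_zero.mpr hq.1
    exact h2.isOpen_inter_preimage h1 hV
  convert Frag.isOpen_hit _ hW using 1
  ext p
  constructor
  · rintro ⟨s, hs, h1, h2, h3⟩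
    exact ⟨(s, p.1.2.eval s), p.1.2.eval_mem hs, ⟨h1, h2⟩, h3⟩
  · rintro ⟨z, hz, ⟨h1, h2⟩, h3⟩
    refine ⟨z.1, ⟨z.2, hz⟩, h1, h2, ?_⟩
    rw [Frag.eval_eq _ hz]
    exact h3

/-- the difference quotient -/
noncomputable def Frag.quot (f : X → ℝ) (p : {p : ℝ × Frag X // p.1 ∈ p.2.domSet}) (s : ℝ) : ℝ :=
  (f (p.1.2.eval s) - f (p.1.2.eval p.1.1)) / (s - p.1.1)

/-- the filter along which the derivative is taken -/
def Frag.filt (p : {p : ℝ × Frag X // p.1 ∈ p.2.domSet}) : Filter ℝ :=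
  𝓝[p.1.2.domSet \ {p.1.1}] p.1.1

lemma Frag.eventually_iff (f : X → ℝ) (p : {p : ℝ × Frag X // p.1 ∈ p.2.domSet}) (V : Set ℝ) :
    (∀ᶠ s in Frag.filt p, Frag.quot f p s ∈ Vᶜ) ↔
      ∃ n : ℕ, p ∉ Frag.hitSet f V (1 / ((n : ℝ) + 1)) := by
  unfold Frag.filt
  rw [eventually_nhdsWithin_iff, Metric.eventually_nhds_iff]
  constructor
  · rintro ⟨ε, hε, h⟩
    obtain ⟨n, hn⟩ := exists_nat_one_div_lt hε
    refine ⟨n, ?_⟩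
    rintro ⟨s, hs, h1, h2, h3⟩
    exact h (y := s) (by rw [Real.dist_eq]; linarith) ⟨hs, h1⟩ h3
  · rintro ⟨n, hn⟩
    refine ⟨1 / ((n : ℝ) + 1), by positivity, ?_⟩
    intro s hs hm hV
    exact hn ⟨s, hm.1, hm.2, by rwa [Real.dist_eq] at hs, hV⟩

lemma Frag.neBot_iff (f : X → ℝ) (p : {p : ℝ × Frag X // p.1 ∈ p.2.domSet}) :
    (Frag.filt p).NeBot ↔ ∀ n : ℕ, p ∈ Frag.hitSet f Set.univ (1 / ((n : ℝ) + 1)) := by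
  have := Frag.eventually_iff f p Set.univ
  simp only [Set.compl_univ, Set.mem_empty_iff_false, Filter.eventually_false_iff_eq_bot] at this
  rw [Filter.neBot_iff, Ne, this]
  push Not
  rfl

lemma Frag.exists_tendsto_iff (f : X → ℝ) (p : {p : ℝ × Frag X // p.1 ∈ p.2.domSet})
    (hp : (Frag.filt p).NeBot) :
    (∃ l, Tendsto (Frag.quot f p) (Frag.filt p) (𝓝 l)) ↔
      ∀ m : ℕ, ∃ q : ℚ, ∃ n : ℕ,
        p ∉ Frag.hitSet f {y : ℝ | 1 / ((m : ℝ) + 1) < |y - q|} (1 / ((n : ℝ) + 1)) := by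
  simp only [← Frag.eventually_iff]
  constructor
  · rintro ⟨l, hl⟩ m
    have hm : (0 : ℝ) < 1 / ((m : ℝ) + 1) := by positivity
    obtain ⟨q, hq1, hq2⟩ := exists_rat_btwn (show l < l + 1 / ((m : ℝ) + 1) / 2 by linarith)
    refine ⟨q, ?_⟩
    filter_upwards [Metric.tendsto_nhds.mp hl (1 / ((m : ℝ) + 1) / 2) (by linarith)] with s hs
    rw [Real.dist_eq, abs_lt] at hs
    simp only [Set.mem_compl_iff, Set.mem_setOf_eq, not_lt, abs_le]
    constructor <;> linarith [hs.1, hs.2]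
  · intro h
    have : Cauchy (Filter.map (Frag.quot f p) (Frag.filt p)) := by
      rw [Metric.cauchy_iff]
      refine ⟨hp.map _, ?_⟩
      intro ε hε
      obtain ⟨m, hm⟩ := exists_nat_one_div_lt (show 0 < ε / 2 by linarith)
      obtain ⟨q, hq⟩ := h m
      refine ⟨_, hq, ?_⟩
      intro x hx y hy
      simp only [Set.mem_compl_iff, Set.mem_setOf_eq, not_lt, abs_le] at hx hy
      rw [Real.dist_eq, abs_lt]
      constructor <;> linarith [hx.1, hx.2, hy.1, hy.2]
    exact cauchy_iff_exists_le_nhds.mp this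

lemma Frag.le_iff (f : X → ℝ) (p : {p : ℝ × Frag X // p.1 ∈ p.2.domSet})
    (hp : (Frag.filt p).NeBot) (l c : ℝ) (hl : Tendsto (Frag.quot f p) (Frag.filt p) (𝓝 l)) :
    l ≤ c ↔ ∀ m : ℕ, ∃ n : ℕ,
        p ∉ Frag.hitSet f (Set.Ioi (c + 1 / ((m : ℝ) + 1))) (1 / ((n : ℝ) + 1)) := by
  simp only [← Frag.eventually_iff]
  constructor
  · intro h m
    have hm : (0 : ℝ) < 1 / ((m : ℝ) + 1) := by positivity
    filter_upwards [hl.eventually (gt_mem_nhds (show l < c + 1 / ((m : ℝ) + 1) by linarith))]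
      with s hs
    simpa using hs.le
  · intro h
    refine le_of_forall_pos_le_add fun ε hε => ?_
    obtain ⟨m, hm⟩ := exists_nat_one_div_lt hε
    refine le_of_tendsto hl ?_
    filter_upwards [h m] with s hs
    simp only [Set.compl_Ioi, Set.mem_Iic] at hs
    linarith

end Helpers

/-- directional-derivative part of Lemma 6.1 of the paper.
Let `X` be separable and `f : X → ℝ` continuous.  Then the set `D(f)` of pairs
`(t,G) ∈ Γ̄(X)` such that `t` is a limit point of `dom G` and the derivative
`lim_{dom G ∋ s → t} (f(G(s)) − f(G(t)))/(s−t)` exists is a Borel subset of `ℝ × Frag X`, and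
the map on `Γ̄(X)` equal to this limit on `D(f)` and `0` elsewhere is Borel measurable. -/
theorem derivative_along_fragment_borel
    {X : Type*} [MetricSpace X] [SeparableSpace X] (f : X → ℝ) (hf : Continuous f) :
    MeasurableSet[borel (ℝ × Frag X)]
      {p : ℝ × Frag X | p.1 ∈ p.2.domSet ∧ (𝓝[p.2.domSet \ {p.1}] p.1).NeBot ∧
        ∃ l : ℝ, Tendsto (fun s : ℝ => (f (p.2.eval s) - f (p.2.eval p.1)) / (s - p.1))
          (𝓝[p.2.domSet \ {p.1}] p.1) (𝓝 l)} ∧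
    ∃ F : {p : ℝ × Frag X // p.1 ∈ p.2.domSet} → ℝ,
      (∀ p : {p : ℝ × Frag X // p.1 ∈ p.2.domSet},
        ((𝓝[p.1.2.domSet \ {p.1.1}] p.1.1).NeBot ∧
          ∃ l : ℝ, Tendsto (fun s : ℝ => (f (p.1.2.eval s) - f (p.1.2.eval p.1.1)) / (s - p.1.1))
            (𝓝[p.1.2.domSet \ {p.1.1}] p.1.1) (𝓝 l)) →
        Tendsto (fun s : ℝ => (f (p.1.2.eval s) - f (p.1.2.eval p.1.1)) / (s - p.1.1))
          (𝓝[p.1.2.domSet \ {p.1.1}] p.1.1) (𝓝 (F p))) ∧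
      (∀ p : {p : ℝ × Frag X // p.1 ∈ p.2.domSet},
        ¬((𝓝[p.1.2.domSet \ {p.1.1}] p.1.1).NeBot ∧
          ∃ l : ℝ, Tendsto (fun s : ℝ => (f (p.1.2.eval s) - f (p.1.2.eval p.1.1)) / (s - p.1.1))
            (𝓝[p.1.2.domSet \ {p.1.1}] p.1.1) (𝓝 l)) → F p = 0) ∧
      @Measurable _ _ (MeasurableSpace.comap Subtype.val (borel (ℝ × Frag X)))
        Real.measurableSpace F := by
  letI : MeasurableSpace (ℝ × Frag X) := borel _
  haveI : BorelSpace (ℝ × Frag X) := ⟨rfl⟩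
  have hmeas : ∀ (V : Set ℝ) (_ : IsOpen V) (δ : ℝ), MeasurableSet (Frag.hitSet f V δ) :=
    fun V hV δ => (Frag.isOpen_hitSet f hf V hV δ).measurableSet
  let D : Set {p : ℝ × Frag X // p.1 ∈ p.2.domSet} :=
    {p | (Frag.filt p).NeBot ∧ ∃ l, Tendsto (Frag.quot f p) (Frag.filt p) (𝓝 l)}
  have hD : MeasurableSet D := by
    have : D = {p | (∀ n : ℕ, p ∈ Frag.hitSet f Set.univ (1 / ((n : ℝ) + 1))) ∧
        ∀ m : ℕ, ∃ q : ℚ, ∃ n : ℕ,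
        p ∉ Frag.hitSet f {y : ℝ | 1 / ((m : ℝ) + 1) < |y - q|} (1 / ((n : ℝ) + 1))} := by
      ext p
      simp only [D, Set.mem_setOf_eq, ← Frag.neBot_iff f p]
      exact and_congr_right fun h => Frag.exists_tendsto_iff f p h
    rw [this]
    refine MeasurableSet.inter (s₁ := {p | ∀ n : ℕ, _}) (s₂ := {p | ∀ m : ℕ, _}) ?_ ?_
    · rw [Set.setOf_forall]
      exact MeasurableSet.iInter fun n => hmeas _ isOpen_univ _
    · simp only [Set.setOf_forall, Set.setOf_exists]
      refine MeasurableSet.iInter fun m => MeasurableSet.iUnion fun q =>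
        MeasurableSet.iUnion fun n => (hmeas _ ?_ _).compl
      exact isOpen_lt (by fun_prop) (by fun_prop)
  refine ⟨?_, ?_⟩
  · have h := MeasurableSet.subtype_image Frag.isClosed_gamma.measurableSet hD
    convert h using 1
    ext p
    constructor
    · rintro ⟨h1, h2, h3⟩
      exact ⟨⟨p, h1⟩, ⟨h2, h3⟩, rfl⟩
    · rintro ⟨⟨p, h1⟩, ⟨h2, h3⟩, rfl⟩
      exact ⟨h1, h2, h3⟩
  · let F : {p : ℝ × Frag X // p.1 ∈ p.2.domSet} → ℝ :=
      fun p => if h : p ∈ D then h.2.choose else 0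
    have hF1 : ∀ p ∈ D, Tendsto (Frag.quot f p) (Frag.filt p) (𝓝 (F p)) := by
      intro p hp
      simp only [F, dif_pos hp]
      exact hp.2.choose_spec
    have hF2 : ∀ p, p ∉ D → F p = 0 := fun p hp => dif_neg hp
    refine ⟨F, fun p hp => hF1 p hp, fun p hp => hF2 p hp, ?_⟩
    change Measurable F
    refine measurable_of_Iic fun c => ?_
    have : F ⁻¹' Set.Iic c = (D ∩ {p | ∀ m : ℕ, ∃ n : ℕ,
        p ∉ Frag.hitSet f (Set.Ioi (c + 1 / ((m : ℝ) + 1))) (1 / ((n : ℝ) + 1))}) ∪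
        (Dᶜ ∩ {_p | 0 ≤ c}) := by
      ext p
      by_cases hp : p ∈ D
      · have := Frag.le_iff f p hp.1 (F p) c (hF1 p hp)
        simp only [Set.mem_preimage, Set.mem_Iic, this, Set.mem_union, Set.mem_inter_iff, hp,
          true_and, Set.mem_compl_iff, not_true, false_and, or_false, Set.mem_setOf_eq]
      · simp [hp, hF2 p hp]
    rw [this]
    refine (hD.inter ?_).union (hD.compl.inter (MeasurableSet.const _))
    simp only [Set.setOf_forall, Set.setOf_exists]
    exact MeasurableSet.iInter fun m => MeasurableSet.iUnion fun n =>
      (hmeas _ isOpen_Ioi _).compl
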